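/- Let K be an irreducible kernel on a countable set X with all convolution powers finite. Then there exists a function f : X → (0,∞) with Σ_{y∈X} k(x,y) f(y) ≤ ρ(K) · f(x) for all x ∈ X. Consequently, ρ(K) = min{ t > 0 : there exists f : X → (0,∞) with Σ_{y∈X} k(x,y) f(y) ≤ t · f(x) for all x ∈ X }, i.e. the minimum is attained at t = ρ(K). -/

import Mathlib

open Filter
open scoped ENNReal NNReal

/-- Convolution powers of a kernel: `k^(0)(x,y) = 1` if `x = y` and `0` otherwise, and
`k^(n+1)(x,y) = Σ_z k^(n)(x,z) * k(z,y)`. -/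
noncomputable def kpow {X : Type*} [DecidableEq X] (k : X → X → ℝ≥0∞) : ℕ → X → X → ℝ≥0∞
  | 0 => fun x y => if x = y then 1 else 0
  | n + 1 => fun x y => ∑' z, kpow k n x z * k z y

/-- A kernel is irreducible if for all `x, y` there is `l ≥ 1` with `k^(l)(x,y) > 0`. -/
def KIrred {X : Type*} [DecidableEq X] (k : X → X → ℝ≥0∞) : Prop :=
  ∀ x y, ∃ l, 1 ≤ l ∧ 0 < kpow k l x y

/-- The Green function `G(x,y|z) = Σ_n k^(n)(x,y) * zⁿ`. -/
noncomputable def green {X : Type*} [DecidableEq X] (k : X → X → ℝ≥0∞) (x y : X)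
    (z : ℝ≥0∞) : ℝ≥0∞ :=
  ∑' n, kpow k n x y * z ^ n

/-- The radius of convergence of the Green function `G(x,y|·)`: the supremum of the set of
`z` at which the series converges (is finite). -/
noncomputable def convRadius {X : Type*} [DecidableEq X] (k : X → X → ℝ≥0∞) (x y : X) : ℝ≥0∞ :=
  sSup {z : ℝ≥0∞ | green k x y z ≠ ⊤}

/-- `limsup_n (k^(n)(x,y))^{1/n}`. -/
noncomputable def rhoAt {X : Type*} [DecidableEq X] (k : X → X → ℝ≥0∞) (x y : X) : ℝ≥0∞ :=
  Filter.limsup (fun n : ℕ => (kpow k n x y) ^ (1 / (n : ℝ))) Filter.atTop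

section

variable {X : Type*} [DecidableEq X] (k : X → X → ℝ≥0∞)

lemma kpow_one (x y : X) : kpow k 1 x y = k x y := by
  simp only [kpow]
  rw [tsum_eq_single x (fun z hz => by simp [Ne.symm hz])]
  simp

lemma kpow_add (m n : ℕ) (x y : X) :
    kpow k (m + n) x y = ∑' z, kpow k m x z * kpow k n z y := by
  induction n generalizing y with
  | zero =>
    simp only [kpow, add_zero]
    rw [tsum_eq_single y (fun z hz => by simp [hz])]
    simp
  | succ n ih =>
    rw [← add_assoc]
    simp only [kpow, ih, ← ENNReal.tsum_mul_left, ← ENNReal.tsum_mul_right]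
    rw [ENNReal.tsum_comm]
    simp only [mul_assoc]

lemma kpow_mul_kpow_le (m n : ℕ) (x y w : X) :
    kpow k m x y * kpow k n y w ≤ kpow k (m + n) x w := by
  rw [kpow_add]
  exact ENNReal.le_tsum y

lemma kpow_mul_pow_mul_green_le (m : ℕ) (x y w : X) (z : ℝ≥0∞) :
    kpow k m x y * z ^ m * green k y w z ≤ green k x w z := by
  unfold green
  rw [← ENNReal.tsum_mul_left]
  calc ∑' n, kpow k m x y * z ^ m * (kpow k n y w * z ^ n)
      ≤ ∑' n, kpow k (m + n) x w * z ^ (m + n) := by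
        refine ENNReal.tsum_le_tsum fun n => ?_
        rw [mul_mul_mul_comm, ← pow_add]
        gcongr
        exact kpow_mul_kpow_le k m n x y w
    _ ≤ ∑' n, kpow k n x w * z ^ n :=
        ENNReal.tsum_comp_le_tsum_of_injective (add_right_injective m)
          fun n => kpow k n x w * z ^ n

lemma one_le_green_self (x : X) (z : ℝ≥0∞) : 1 ≤ green k x x z := by
  simpa [kpow, green] using ENNReal.le_tsum (f := fun n => kpow k n x x * z ^ n) 0

/-- The Green function at `1 / t` is `t`-superharmonic in its first variable. -/
lemma tsum_mul_green_inv_le {t : ℝ≥0∞} (ht : t ≠ 0) (ht' : t ≠ ⊤) (x w : X) :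
    ∑' y, k x y * green k y w t⁻¹ ≤ t * green k x w t⁻¹ := by
  unfold green
  calc ∑' y, k x y * ∑' n, kpow k n y w * t⁻¹ ^ n
      = ∑' n, kpow k (1 + n) x w * t⁻¹ ^ n := by
        simp only [kpow_add, kpow_one, ← ENNReal.tsum_mul_left, ← ENNReal.tsum_mul_right]
        rw [ENNReal.tsum_comm]
        simp only [mul_assoc]
    _ = t * ∑' n, kpow k (1 + n) x w * t⁻¹ ^ (1 + n) := by
        rw [← ENNReal.tsum_mul_left]
        refine tsum_congr fun n => ?_
        rw [pow_add, pow_one, mul_left_comm, ← mul_assoc t, ENNReal.mul_inv_cancel ht ht', one_mul]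
    _ ≤ t * ∑' n, kpow k n x w * t⁻¹ ^ n := by
        refine mul_le_mul_right ?_ t
        exact ENNReal.tsum_comp_le_tsum_of_injective (add_right_injective 1)
          fun n => kpow k n x w * t⁻¹ ^ n

variable {k}

lemma green_inv_ne_top (hfin : ∀ n x y, kpow k n x y ≠ ⊤) {x y : X} {t : ℝ≥0∞}
    (ht : rhoAt k x y < t) : green k x y t⁻¹ ≠ ⊤ := by
  obtain ⟨r, hr, hrt⟩ := exists_between ht
  have ht0 : t ≠ 0 := (bot_le.trans_lt ht).ne'
  obtain ⟨N, hN⟩ := eventually_atTop.1 (eventually_lt_of_limsup_lt hr)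
  have hle : ∀ n, kpow k (n + (N + 1)) x y * t⁻¹ ^ (n + (N + 1)) ≤ (r * t⁻¹) ^ n := by
    intro n
    have h := (hN (n + (N + 1)) (by omega)).le
    have hpos : (0 : ℝ) < ((n + (N + 1) : ℕ) : ℝ) := by positivity
    rw [one_div, ENNReal.rpow_inv_le_iff hpos, ENNReal.rpow_natCast] at h
    calc kpow k (n + (N + 1)) x y * t⁻¹ ^ (n + (N + 1))
        ≤ r ^ (n + (N + 1)) * t⁻¹ ^ (n + (N + 1)) := by gcongr
      _ = (r * t⁻¹) ^ (n + (N + 1)) := (mul_pow _ _ _).symm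
      _ ≤ (r * t⁻¹) ^ n := by
        refine pow_le_pow_right_of_le_one' ?_ (by omega)
        rw [← div_eq_mul_inv]
        exact ENNReal.div_le_of_le_mul (by simpa using hrt.le)
  unfold green
  rw [← ENNReal.summable.sum_add_tsum_nat_add' (k := N + 1)]
  refine ENNReal.add_ne_top.2 ⟨?_, ?_⟩
  · exact ENNReal.sum_ne_top.2 fun n _ =>
      ENNReal.mul_ne_top (hfin n x y) (ENNReal.pow_ne_top (ENNReal.inv_ne_top.2 ht0))
  · refine ne_top_of_le_ne_top ?_ (ENNReal.tsum_le_tsum hle)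
    rw [ENNReal.tsum_geometric, ENNReal.inv_ne_top, ← pos_iff_ne_zero, tsub_pos_iff_lt,
      ← div_eq_mul_inv]
    exact ENNReal.div_lt_of_lt_mul (by simpa using hrt)

lemma kpow_self_le_pow {f : X → ℝ≥0∞} {t : ℝ≥0∞} (hf : ∀ x, 0 < f x ∧ f x ≠ ⊤)
    (h : ∀ x, ∑' y, k x y * f y ≤ t * f x) (n : ℕ) (x : X) : kpow k n x x ≤ t ^ n := by
  have key : ∀ x, ∑' y, kpow k n x y * f y ≤ t ^ n * f x := by
    induction n with
    | zero =>
      intro x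
      simp only [kpow]
      rw [tsum_eq_single x (fun z hz => by simp [Ne.symm hz])]
      simp
    | succ n ih =>
      intro x
      calc ∑' y, kpow k (n + 1) x y * f y
          = ∑' z, kpow k n x z * ∑' y, k z y * f y := by
            simp only [kpow, ← ENNReal.tsum_mul_left, ← ENNReal.tsum_mul_right]
            rw [ENNReal.tsum_comm]
            simp only [mul_assoc]
        _ ≤ ∑' z, t * (kpow k n x z * f z) := by
            refine ENNReal.tsum_le_tsum fun z => ?_
            rw [mul_left_comm]
            gcongr
            exact h z
        _ ≤ t * (t ^ n * f x) := by
            rw [ENNReal.tsum_mul_left]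
            gcongr
            exact ih x
        _ = t ^ (n + 1) * f x := by ring
  exact (ENNReal.mul_le_mul_iff_left (hf x).1.ne' (hf x).2).1
    ((ENNReal.le_tsum (f := fun y => kpow k n x y * f y) x).trans (key x))

lemma rhoAt_self_le {f : X → ℝ≥0∞} {t : ℝ≥0∞} (hf : ∀ x, 0 < f x ∧ f x ≠ ⊤)
    (h : ∀ x, ∑' y, k x y * f y ≤ t * f x) (x : X) : rhoAt k x x ≤ t := by
  refine limsup_le_of_le (h := ?_)
  filter_upwards [eventually_gt_atTop 0] with n hn
  rw [one_div, ENNReal.rpow_inv_le_iff (by exact_mod_cast hn), ENNReal.rpow_natCast]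
  exact kpow_self_le_pow hf h n x

lemma KIrred.pos_of_superharmonic (hirr : KIrred k) {f : X → ℝ≥0∞} {t : ℝ≥0∞}
    (hf : ∀ x, 0 < f x ∧ f x ≠ ⊤) (h : ∀ x, ∑' y, k x y * f y ≤ t * f x) (x : X) : 0 < t := by
  obtain ⟨l, hl, hpos⟩ := hirr x x
  rw [pos_iff_ne_zero]
  rintro rfl
  have := hpos.trans_le (kpow_self_le_pow hf h l x)
  simp [Nat.one_le_iff_ne_zero.1 hl] at this

/-- Fatou's lemma for series. -/
lemma ENNReal.tsum_liminf_le {Y : Type*} (u : ℕ → Y → ℝ≥0∞) :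
    ∑' y, liminf (fun n => u n y) atTop ≤ liminf (fun n => ∑' y, u n y) atTop := by
  let _ : MeasurableSpace Y := ⊤
  simpa only [MeasureTheory.lintegral_count] using
    MeasureTheory.lintegral_liminf_le (μ := MeasureTheory.Measure.count) (f := u)
      fun n => measurable_from_top

/-- The normalized Green functions at `1 / t` with `t ↓ ρ` have a `ρ`-superharmonic lower limit. -/
lemma KIrred.exists_superharmonic (hirr : KIrred k) (hfin : ∀ n x y, kpow k n x y ≠ ⊤) (x₀ : X) :
    ∃ f : X → ℝ≥0∞, (∀ x, 0 < f x ∧ f x ≠ ⊤) ∧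
      ∀ x, ∑' y, k x y * f y ≤ rhoAt k x₀ x₀ * f x := by
  rcases eq_or_ne (rhoAt k x₀ x₀) ⊤ with hρ | hρ
  · exact ⟨1, by simp, by simp [hρ]⟩
  set ρ := rhoAt k x₀ x₀
  obtain ⟨t, t_anti, htρ, t_tendsto⟩ : ∃ t : ℕ → ℝ≥0∞, StrictAnti t ∧
      (∀ n, t n ∈ Set.Ioo ρ ⊤) ∧ Tendsto t atTop (nhds ρ) :=
    exists_seq_strictAnti_tendsto' hρ.lt_top
  have ht0 : ∀ n, t n ≠ 0 := fun n => (bot_le.trans_lt (htρ n).1).ne'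
  have ht_top : ∀ n, t n ≠ ⊤ := fun n => (htρ n).2.ne
  have ht_le : ∀ n, t n ≤ t 0 := fun n => t_anti.antitone (Nat.zero_le n)
  set c : ℕ → ℝ≥0∞ := fun n => green k x₀ x₀ (t n)⁻¹
  have hc0 : ∀ n, c n ≠ 0 := fun n =>
    (zero_lt_one.trans_le (one_le_green_self k x₀ (t n)⁻¹)).ne'
  have hc_top : ∀ n, c n ≠ ⊤ := fun n => green_inv_ne_top hfin (htρ n).1
  set g : ℕ → X → ℝ≥0∞ := fun n x => green k x x₀ (t n)⁻¹ / c n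
  have hg : ∀ n x, ∑' y, k x y * g n y ≤ t n * g n x := by
    intro n x
    simp only [g, div_eq_mul_inv, ← mul_assoc, ENNReal.tsum_mul_right]
    gcongr
    exact tsum_mul_green_inv_le k (ht0 n) (ht_top n) x x₀
  have hf_pos : ∀ x, 0 < liminf (fun n => g n x) atTop := by
    intro x
    obtain ⟨l, -, hl⟩ := hirr x x₀
    have hlow : ∀ n, kpow k l x x₀ * (t 0)⁻¹ ^ l ≤ g n x := by
      intro n
      rw [ENNReal.le_div_iff_mul_le (Or.inl (hc0 n)) (Or.inl (hc_top n))]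
      refine le_trans ?_ (kpow_mul_pow_mul_green_le k l x x₀ x₀ (t n)⁻¹)
      gcongr
      exact ht_le n
    refine lt_of_lt_of_le ?_ (le_liminf_of_le (h := Eventually.of_forall hlow))
    exact ENNReal.mul_pos hl.ne' (pow_ne_zero _ (ENNReal.inv_ne_zero.2 (ht_top 0)))
  have hf_top : ∀ x, liminf (fun n => g n x) atTop ≠ ⊤ := by
    intro x
    obtain ⟨m, -, hm⟩ := hirr x₀ x
    have ha0 : kpow k m x₀ x * (t 0)⁻¹ ^ m ≠ 0 :=
      mul_ne_zero hm.ne' (pow_ne_zero _ (ENNReal.inv_ne_zero.2 (ht_top 0)))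
    have hup : ∀ n, g n x ≤ (kpow k m x₀ x * (t 0)⁻¹ ^ m)⁻¹ := by
      intro n
      refine ENNReal.div_le_of_le_mul ?_
      rw [mul_comm, ← div_eq_mul_inv, ENNReal.le_div_iff_mul_le (Or.inl ha0)
        (Or.inr (hc_top n)), mul_comm]
      refine le_trans ?_ (kpow_mul_pow_mul_green_le k m x₀ x x₀ (t n)⁻¹)
      gcongr
      exact ht_le n
    refine ne_top_of_le_ne_top (ENNReal.inv_ne_top.2 ha0) ?_
    exact liminf_le_of_frequently_le' (Frequently.of_forall hup)
  refine ⟨fun x => liminf (fun n => g n x) atTop, fun x => ⟨hf_pos x, hf_top x⟩, fun x => ?_⟩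
  have hK : ∑' y, k x y * liminf (fun n => g n y) atTop ≤
      liminf (fun n => t n * g n x) atTop := by
    refine le_trans (ENNReal.tsum_le_tsum fun y => ?_)
      ((ENNReal.tsum_liminf_le fun n y => k x y * g n y).trans
        (liminf_le_liminf (Eventually.of_forall fun n => hg n x)))
    have hk : k x y ≠ ⊤ := kpow_one k x y ▸ hfin 1 x y
    exact (ENNReal.liminf_const_mul_of_ne_top hk).ge
  have hN : ∀ N, ∑' y, k x y * liminf (fun n => g n y) atTop ≤
      t N * liminf (fun n => g n x) atTop := by
    intro N
    rw [← ENNReal.liminf_const_mul_of_ne_top (ht_top N)]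
    refine hK.trans (liminf_le_liminf ?_)
    filter_upwards [eventually_ge_atTop N] with n hn
    gcongr
    exact t_anti.antitone hn
  exact ge_of_tendsto' (ENNReal.Tendsto.mul_const t_tendsto (Or.inr (hf_top x))) hN

end

/-- For an irreducible kernel with finite convolution powers there exists a positive finite
function `f` with `Σ_y k(x,y) f(y) ≤ ρ(K) * f(x)` for all `x`; consequently
`ρ(K) = min { t > 0 : ∃ f > 0 with Σ_y k(x,y) f(y) ≤ t * f(x) ∀ x }`, the minimum being
attained at `t = ρ(K)`. -/
theorem rho_eq_min_superharmonic {X : Type*} [Countable X] [DecidableEq X] (k : X → X → ℝ≥0∞)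
    (hfin : ∀ n x y, kpow k n x y ≠ ⊤) (hirr : KIrred k) :
    ∀ x₀ : X,
      (∃ f : X → ℝ≥0∞, (∀ x, 0 < f x ∧ f x ≠ ⊤) ∧
        ∀ x, ∑' y, k x y * f y ≤ rhoAt k x₀ x₀ * f x) ∧
      IsLeast {t : ℝ≥0∞ | 0 < t ∧ ∃ f : X → ℝ≥0∞, (∀ x, 0 < f x ∧ f x ≠ ⊤) ∧
        ∀ x, ∑' y, k x y * f y ≤ t * f x} (rhoAt k x₀ x₀) := by
  intro x₀
  obtain ⟨f, hf, hfρ⟩ := hirr.exists_superharmonic hfin x₀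
  refine ⟨⟨f, hf, hfρ⟩, ⟨hirr.pos_of_superharmonic hf hfρ x₀, f, hf, hfρ⟩, ?_⟩
  rintro t ⟨-, g, hg, hgt⟩
  exact rhoAt_self_le hg hgt x₀
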